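/- Let f be a partial Boolean function. For every ε ∈ (0, 1/2), R_ε(f) ≤ 14 · (ln(1/ε)/(1 − 2ε)²) · R̄_ε(f). For ε = 1/3 this can be improved to R(f) ≤ 10 · R̄(f). -/

import Mathlib

/-! ### Decision trees -/

/-- A deterministic decision tree querying positions of type `ι`, receiving answers
in `α`, and producing an output in `β`. -/
inductive DTree (ι α β : Type) : Type
  | leaf (b : β) : DTree ι α β
  | node (i : ι) (next : α → DTree ι α β) : DTree ι α β

namespace DTree

variable {ι α β : Type}

/-- The output of a decision tree on input `x`. -/
def output : DTree ι α β → (ι → α) → β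
  | leaf b, _ => b
  | node i next, x => (next (x i)).output x

/-- The number of queries made by a decision tree on input `x`. -/
def cost : DTree ι α β → (ι → α) → ℕ
  | leaf _, _ => 0
  | node i next, x => (next (x i)).cost x + 1

/-- The set of positions queried by a decision tree on input `x`. -/
def queries : DTree ι α β → (ι → α) → Set ι
  | leaf _, _ => ∅
  | node i next, x => insert i ((next (x i)).queries x)

end DTree

/-- A partial function on inputs `ι → α` with outputs in `β`; `none` means undefined
(the domain is the set of inputs mapped to `some` value). -/
abbrev PFn (ι α β : Type) := (ι → α) → Option β

/-- `t` computes the partial function `f` (correct on every input of the domain). -/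
def DTree.computesP {ι α β : Type} (t : DTree ι α β) (f : PFn ι α β) : Prop :=
  ∀ x b, f x = some b → t.output x = b

/-- Deterministic query complexity `D(f)`. -/
noncomputable def Dq {ι α β : Type} (f : PFn ι α β) : ℝ :=
  sInf {T : ℝ | 0 ≤ T ∧ ∃ t : DTree ι α β, t.computesP f ∧ ∀ x, (t.cost x : ℝ) ≤ T}

/-! ### Randomized query algorithms -/

/-- A randomized query algorithm: a finitely supported probability distribution over
deterministic decision trees. -/
structure RandAlg (ι α β : Type) where
  Ω : Type
  [fin : Fintype Ω]
  p : Ω → ℝ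
  nonneg : ∀ ω, 0 ≤ p ω
  sum_one : ∑ ω, p ω = 1
  tree : Ω → DTree ι α β

namespace RandAlg

variable {ι α β : Type}

/-- Expected number of queries of `A` on input `x`. -/
noncomputable def expCost (A : RandAlg ι α β) (x : ι → α) : ℝ :=
  letI := A.fin
  ∑ ω, A.p ω * ((A.tree ω).cost x : ℝ)

open Classical in
/-- Probability that `A` outputs `b` on input `x`. -/
noncomputable def succProb (A : RandAlg ι α β) (x : ι → α) (b : β) : ℝ :=
  letI := A.fin
  ∑ ω, if (A.tree ω).output x = b then A.p ω else 0

/-- `A` computes `f` with error at most `ε`: on every input of the domain the correct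
output is produced with probability at least `1 - ε`. -/
def Computes (A : RandAlg ι α β) (f : PFn ι α β) (ε : ℝ) : Prop :=
  ∀ x b, f x = some b → 1 - ε ≤ A.succProb x b

/-- The worst-case cost of `A` (over all inputs and all trees in the support) is at most `T`. -/
def WCostLe (A : RandAlg ι α β) (T : ℝ) : Prop :=
  ∀ ω, A.p ω ≠ 0 → ∀ x, ((A.tree ω).cost x : ℝ) ≤ T

/-- The expected cost of `A` on every input of the domain of `f` is at most `T`. -/
def ECostLe (A : RandAlg ι α β) (f : PFn ι α β) (T : ℝ) : Prop :=
  ∀ x, (f x).isSome → A.expCost x ≤ T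

end RandAlg

/-- `R_ε(f)`: minimum worst-case cost of an `ε`-error randomized algorithm for `f`. -/
noncomputable def Rw {ι α β : Type} (ε : ℝ) (f : PFn ι α β) : ℝ :=
  sInf {T : ℝ | 0 ≤ T ∧ ∃ A : RandAlg ι α β, A.Computes f ε ∧ A.WCostLe T}

/-- `R̄_ε(f)`: minimum expected cost of an `ε`-error randomized algorithm for `f`. -/
noncomputable def Rbar {ι α β : Type} (ε : ℝ) (f : PFn ι α β) : ℝ :=
  sInf {T : ℝ | 0 ≤ T ∧ ∃ A : RandAlg ι α β, A.Computes f ε ∧ A.ECostLe f T}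

/-- `R₀(f)`: zero-error expected randomized query complexity. -/
noncomputable def R0 {ι α β : Type} (f : PFn ι α β) : ℝ := Rbar 0 f

/-- `R(f) := R_{1/3}(f)`: bounded-error randomized query complexity. -/
noncomputable def Rb {ι α β : Type} (f : PFn ι α β) : ℝ := Rw (1/3) f

/-- The total function `f` viewed as a partial function. -/
def tot {ι α β : Type} (f : (ι → α) → β) : PFn ι α β := fun x => some (f x)


namespace RwAux

/-- Run `t` with a query budget, then continue with the (optional) result and remaining budget. -/
def bindT {J : Type} : DTree J Bool Bool → ℕ → (Option Bool → ℕ → DTree J Bool Bool) →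
    DTree J Bool Bool
  | .leaf o, b, K => K (some o) b
  | .node _ _, 0, K => K none 0
  | .node i next, b+1, K => .node i (fun a => bindT (next a) b K)

theorem bindT_output {J : Type} (t : DTree J Bool Bool) (b : ℕ)
    (K : Option Bool → ℕ → DTree J Bool Bool) (x : J → Bool) :
    (bindT t b K).output x =
      if t.cost x ≤ b then (K (some (t.output x)) (b - t.cost x)).output x
      else (K none 0).output x := by
  induction t generalizing b with
  | leaf o => simp [bindT, DTree.output, DTree.cost]
  | node i next ih =>
    cases b with
    | zero => simp [bindT, DTree.cost]
    | succ b =>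
      simp only [bindT, DTree.output, DTree.cost, ih]
      simp

theorem bindT_cost {J : Type} (t : DTree J Bool Bool) (b M : ℕ)
    (K : Option Bool → ℕ → DTree J Bool Bool) (x : J → Bool)
    (h : ∀ o b', b' ≤ b → (K o b').cost x + (b - b') ≤ M) :
    (bindT t b K).cost x ≤ M := by
  induction t generalizing b M with
  | leaf o => simpa [bindT] using h (some o) b le_rfl
  | node i next ih =>
    cases b with
    | zero => simpa [bindT] using h none 0 le_rfl
    | succ b =>
      simp only [bindT, DTree.cost]
      have h0 := h none b (by omega)
      have := ih (x i) b (M-1) (fun o b' hb => by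
        have := h o b' (by omega)
        omega)
      omega

/-- A family of randomized algorithms, indexed by a state, with common randomness. -/
structure Fam (J S : Type) where
  Ω : Type
  fin : Fintype Ω
  p : Ω → ℝ
  nonneg : ∀ ω, 0 ≤ p ω
  sum_one : ∑ ω, p ω = 1
  tree : S → Ω → DTree J Bool Bool

def Fam.at {J S : Type} (F : Fam J S) (s : S) : RandAlg J Bool Bool :=
  letI := F.fin
  { Ω := F.Ω, p := F.p, nonneg := F.nonneg, sum_one := F.sum_one, tree := F.tree s }

noncomputable def wt : Fin 4 → ℝ := ![1/3, 1/6, 1/6, 1/3]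

/-- The final guess: read off the sign of the (signed) count `d s`, with a random hedge. -/
noncomputable def guessFam (J : Type) {S : Type} (d : S → ℤ) : Fam J S where
  Ω := Fin 4
  fin := inferInstance
  p := wt
  nonneg := by intro i; fin_cases i <;> norm_num [wt]
  sum_one := by simp [Fin.sum_univ_four, wt]; norm_num
  tree s c := .leaf (decide ((c : ℤ) < 2 + d s))

noncomputable def stepFam {J S : Type} (A : RandAlg J Bool Bool) (bud : S → ℕ)
    (upd : S → Option Bool → ℕ → S) (halt : S → Bool) (F : Fam J S) : Fam J S :=
  letI := A.fin
  letI := F.fin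
  { Ω := A.Ω × F.Ω
    fin := inferInstance
    p := fun r => A.p r.1 * F.p r.2
    nonneg := fun r => mul_nonneg (A.nonneg _) (F.nonneg _)
    sum_one := by
      rw [Fintype.sum_prod_type]
      simp [← Finset.mul_sum, F.sum_one, A.sum_one]
    tree := fun s r => if halt s then F.tree s r.2 else
      bindT (A.tree r.1) (bud s) (fun o b' => F.tree (upd s o b') r.2) }

noncomputable def mach {J S : Type} (A : RandAlg J Bool Bool) (bud : S → ℕ)
    (upd : S → Option Bool → ℕ → S) (halt : S → Bool) (d : S → ℤ) : ℕ → Fam J S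
  | 0 => guessFam J d
  | k+1 => stepFam A bud upd halt (mach A bud upd halt d k)

/-- signed count relative to the target bit -/
def sg (b : Bool) (D : ℤ) : ℤ := if b then D else -D

/-- success probability of the guess -/
noncomputable def G (e : ℤ) : ℝ :=
  if e ≤ -2 then 0 else if e = -1 then 1/3 else if e = 0 then 1/2 else if e = 1 then 2/3 else 1

theorem at_succ {J S : Type} (F : Fam J S) (s : S) (x : J → Bool) (b : Bool) :
    (F.at s).succProb x b =
      @Finset.sum F.Ω ℝ _ (@Finset.univ F.Ω F.fin)
        (fun ω => if (F.tree s ω).output x = b then F.p ω else 0) := by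
  refine Finset.sum_congr rfl fun ω _ => ?_
  by_cases h : (F.tree s ω).output x = b
  · exact (if_pos h).trans (if_pos h).symm
  · exact (if_neg h).trans (if_neg h).symm

theorem guess_succ {J S : Type} (d : S → ℤ) (s : S) (x : J → Bool) (b : Bool) :
    ((guessFam J d).at s).succProb x b = G (sg b (d s)) := by
  rw [at_succ]
  change (∑ c : Fin 4, if decide ((c : ℤ) < 2 + d s) = b then wt c else 0) = _
  rw [Fin.sum_univ_four]
  generalize d s = D
  have w0 : wt 0 = 1/3 := rfl
  have w1 : wt 1 = 1/6 := rfl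
  have w2 : wt 2 = 1/6 := rfl
  have w3 : wt 3 = 1/3 := rfl
  have h : D ≤ -2 ∨ D = -1 ∨ D = 0 ∨ D = 1 ∨ 2 ≤ D := by omega
  rcases h with h | h | h | h | h
  · have e1 : ¬ (0 < 2 + D) := by omega
    have e2 : ¬ (1 < 2 + D) := by omega
    have e3 : ¬ (2 < 2 + D) := by omega
    have e4 : ¬ (3 < 2 + D) := by omega
    cases b
    · have f1 : ¬ (-D ≤ -2) := by omega
      have f2 : ¬ (-D = -1) := by omega
      have f3 : ¬ (-D = 0) := by omega
      have f4 : ¬ (-D = 1) := by omega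
      simp only [sg, G, Bool.false_eq_true, if_false, f1, f2, f3, f4]
      simp [e1, e2, e3, e4, w0, w1, w2, w3]; norm_num
    · simp [sg, G, e1, e2, e3, e4, h]
  · subst h; cases b <;> norm_num [sg, G, w0, w1, w2, w3]
  · subst h; cases b <;> norm_num [sg, G, w0, w1, w2, w3]
  · subst h; cases b <;> norm_num [sg, G, w0, w1, w2, w3]
  · have e1 : (0 < 2 + D) := by omega
    have e2 : (1 < 2 + D) := by omega
    have e3 : (2 < 2 + D) := by omega
    have e4 : (3 < 2 + D) := by omega
    cases b
    · have f1 : (-D ≤ -2) := by omega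
      simp only [sg, G, Bool.false_eq_true, if_false, f1]
      simp [e1, e2, e3, e4]
    · have f1 : ¬ (D ≤ -2) := by omega
      have f2 : ¬ (D = -1) := by omega
      have f3 : ¬ (D = 0) := by omega
      have f4 : ¬ (D = 1) := by omega
      simp only [sg, G, if_true, f1, f2, f3, f4, if_false]
      simp [e1, e2, e3, e4, w0, w1, w2, w3]; norm_num

theorem step_succ_halt {J S : Type} (A : RandAlg J Bool Bool) (bud : S → ℕ)
    (upd : S → Option Bool → ℕ → S) (halt : S → Bool) (F : Fam J S) (s : S)
    (hs : halt s = true) (x : J → Bool) (b : Bool) :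
    ((stepFam A bud upd halt F).at s).succProb x b = (F.at s).succProb x b := by
  letI := A.fin
  letI := F.fin
  rw [at_succ, at_succ]
  change (∑ r : A.Ω × F.Ω, if (if halt s then F.tree s r.2 else
      bindT (A.tree r.1) (bud s) (fun o b' => F.tree (upd s o b') r.2)).output x = b
      then A.p r.1 * F.p r.2 else 0) = _
  simp only [hs, if_true]
  rw [Fintype.sum_prod_type]
  simp only [← mul_ite_zero, ← Finset.mul_sum, ← Finset.sum_mul, A.sum_one, one_mul]

/-- the state after running tree `t` from state `s` -/
def nxt {J S : Type} (bud : S → ℕ) (upd : S → Option Bool → ℕ → S) (t : DTree J Bool Bool)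
    (x : J → Bool) (s : S) : S :=
  if t.cost x ≤ bud s then upd s (some (t.output x)) (bud s - t.cost x) else upd s none 0

theorem step_succ {J S : Type} (A : RandAlg J Bool Bool) (bud : S → ℕ)
    (upd : S → Option Bool → ℕ → S) (halt : S → Bool) (F : Fam J S) (s : S)
    (hs : halt s = false) (x : J → Bool) (b : Bool) :
    ((stepFam A bud upd halt F).at s).succProb x b =
      letI := A.fin
      ∑ ω, A.p ω * (F.at (nxt bud upd (A.tree ω) x s)).succProb x b := by
  letI := A.fin
  letI := F.fin
  rw [at_succ]
  simp only [at_succ]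
  change (∑ r : A.Ω × F.Ω, if (if halt s then F.tree s r.2 else
      bindT (A.tree r.1) (bud s) (fun o b' => F.tree (upd s o b') r.2)).output x = b
      then A.p r.1 * F.p r.2 else 0) = _
  simp only [hs]
  rw [Fintype.sum_prod_type]
  refine Finset.sum_congr rfl fun ω _ => ?_
  rw [Finset.mul_sum]
  refine Finset.sum_congr rfl fun r _ => ?_
  rw [mul_ite_zero]
  simp only [Bool.false_eq_true, if_false, bindT_output, nxt]
  split_ifs <;> rfl

theorem mach_succ_halt {J S : Type} (A : RandAlg J Bool Bool) (bud : S → ℕ)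
    (upd : S → Option Bool → ℕ → S) (halt : S → Bool) (d : S → ℤ) (k : ℕ) (s : S)
    (hs : halt s = true) (x : J → Bool) (b : Bool) :
    ((mach A bud upd halt d k).at s).succProb x b = G (sg b (d s)) := by
  induction k with
  | zero => exact guess_succ d s x b
  | succ k ih => rw [mach, step_succ_halt _ _ _ _ _ _ hs, ih]

/-- one-step averaging -/
theorem avg_bound {J : Type} (A : RandAlg J Bool Bool) (x : J → Bool) (b : Bool) (ε T : ℝ)
    (hs : 1 - ε ≤ A.succProb x b) (hc : A.expCost x ≤ T) (a c l : ℝ) (hca : 0 ≤ c)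
    (hl : 0 ≤ l) (V : A.Ω → ℝ)
    (hV : ∀ ω, a + (if (A.tree ω).output x = b then c else 0) - l * (A.tree ω).cost x ≤ V ω) :
    a + c * (1 - ε) - l * T ≤ letI := A.fin; ∑ ω, A.p ω * V ω := by
  letI := A.fin
  have h1 : ∑ ω, A.p ω * (a + (if (A.tree ω).output x = b then c else 0)
      - l * (A.tree ω).cost x) ≤ ∑ ω, A.p ω * V ω :=
    Finset.sum_le_sum fun ω _ => mul_le_mul_of_nonneg_left (hV ω) (A.nonneg ω)
  have h2 : ∑ ω, A.p ω * (a + (if (A.tree ω).output x = b then c else 0)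
      - l * (A.tree ω).cost x) = a + c * A.succProb x b - l * A.expCost x := by
    unfold RandAlg.succProb RandAlg.expCost
    have : a = ∑ ω, A.p ω * a := by rw [← Finset.sum_mul, A.sum_one, one_mul]
    conv_rhs => rw [this]
    rw [Finset.mul_sum, Finset.mul_sum, ← Finset.sum_add_distrib, ← Finset.sum_sub_distrib]
    refine Finset.sum_congr rfl fun ω _ => ?_
    split_ifs <;> ring
  have := mul_le_mul_of_nonneg_left hs hca
  have := mul_le_mul_of_nonneg_left hc hl
  linarith

/-! ### The joint-budget machine -/

def pm (o : Bool) : ℤ := if o then 1 else -1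

theorem sg_pm (b o : Bool) (D : ℤ) : sg b (D + pm o) = sg b D + (if o = b then 1 else -1) := by
  cases b <;> cases o <;> simp [sg, pm] <;> ring

def jbud (s : ℤ × Option ℕ) : ℕ := s.2.getD 0
def jupd (s : ℤ × Option ℕ) : Option Bool → ℕ → ℤ × Option ℕ
  | none, _ => (s.1, none)
  | some o, b => (s.1 + pm o, some b)
def jhalt (s : ℤ × Option ℕ) : Bool := s.2.isNone || decide (2 ≤ s.1) || decide (s.1 ≤ -2)

noncomputable def U (ε : ℝ) (e : ℤ) : ℝ :=
  if e ≤ -2 then 0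
  else if e = -1 then (1-ε)^2 - ε*(1-ε)*(1-2*ε)/2
  else if e = 0 then 1-ε
  else if e = 1 then (1-ε) + ε*(1-ε) - ε*(1-ε)*(1-2*ε)/2
  else 1

theorem joint_cost {J : Type} (A : RandAlg J Bool Bool) (k : ℕ) (s : ℤ × Option ℕ) (r)
    (x : J → Bool) :
    ((mach A jbud jupd jhalt Prod.fst k).tree s r).cost x ≤ jbud s := by
  induction k generalizing s with
  | zero => simp [mach, guessFam, DTree.cost]
  | succ k ih =>
    simp only [mach, stepFam]
    split_ifs with h
    · exact ih s r.2
    · apply bindT_cost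
      intro o b' hb
      have := ih (jupd s o b') r.2
      cases o with
      | none => simp [jupd, jbud] at this ⊢; rw [this]; simp
      | some o =>
        have e : jbud (jupd s (some o) b') = b' := rfl
        rw [e] at this
        omega

theorem joint_succ {J : Type} (A : RandAlg J Bool Bool) (x : J → Bool) (b : Bool) (ε T : ℝ)
    (h0 : 0 < ε) (h1 : ε < 1/2)
    (hs : 1 - ε ≤ A.succProb x b) (hc : A.expCost x ≤ T) (l η L : ℝ) (m N : ℕ)
    (hl : 0 ≤ l) (hη : 0 ≤ η) (hL : L = l * (N+1)) (hm : η * m = L)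
    (hstep : l * T + η ≤ ε*(1-ε)*(1-2*ε)/2)
    (g1 : 1/3 ≤ L) (g0 : U ε 1 - L ≤ 1/2) (gm : (1 - ε) - L ≤ 1/3)
    (k : ℕ) (hk : k ≤ m) (D : ℤ) (bb : ℕ) (hb : bb ≤ N) (hD1 : -1 ≤ D) (hD2 : D ≤ 1) :
    U ε (sg b D) - 2 * L + l * (bb + 1) + η * k ≤
      ((mach A jbud jupd jhalt Prod.fst k).at (D, some bb)).succProb x b := by
  have pq : 0 < ε * (1-ε) := by nlinarith
  have hpq : 0 < ε*(1-ε)*(1-2*ε)/2 := by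
    have : 0 < 1 - 2*ε := by linarith
    positivity
  -- values of U
  have u2 : U ε 2 = 1 := by norm_num [U]
  have u1 : U ε 1 = (1-ε) + ε*(1-ε) - ε*(1-ε)*(1-2*ε)/2 := by norm_num [U]
  have u0 : U ε 0 = 1 - ε := by norm_num [U]
  have um1 : U ε (-1) = (1-ε)^2 - ε*(1-ε)*(1-2*ε)/2 := by norm_num [U]
  have um2 : U ε (-2) = 0 := by norm_num [U]
  have G2 : G 2 = 1 := by norm_num [G]
  have G1 : G 1 = 2/3 := by norm_num [G]
  have G0 : G 0 = 1/2 := by norm_num [G]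
  have Gm1 : G (-1) = 1/3 := by norm_num [G]
  have Gm2 : G (-2) = 0 := by norm_num [G]
  have mono1 : U ε (-1) ≤ U ε 1 := by rw [u1, um1]; nlinarith
  have m12 : U ε 1 ≤ 1 := by rw [u1]; nlinarith
  have mlow : U ε (-1) ≤ 1 - ε := by rw [um1]; nlinarith
  have m01 : 1 - ε ≤ U ε 1 := by rw [u1]; nlinarith
  have hbl : ∀ c : ℕ, c ≤ N → l * ((c:ℝ) + 1) ≤ L := by
    intro c hc
    rw [hL]
    have : (c:ℝ) ≤ N := by exact_mod_cast hc
    gcongr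
  have hηk : ∀ k : ℕ, k ≤ m → η * k ≤ L := by
    intro k hk
    rw [← hm]
    have : (k:ℝ) ≤ m := by exact_mod_cast hk
    gcongr
  -- timeouts
  have tmo : ∀ e : ℤ, -1 ≤ e → e ≤ 1 → U ε (e+1) - L ≤ G e ∧ U ε (e-1) - L ≤ G e ∧
      U ε e - L ≤ G e := by
    intro e he1 he2
    have : e = -1 ∨ e = 0 ∨ e = 1 := by omega
    rcases this with rfl | rfl | rfl
    · norm_num [u0, um1, um2, Gm1]
      rw [um1] at mlow
      refine ⟨by linarith, by linarith, by linarith⟩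
    · norm_num [G0]; rw [u0]
      refine ⟨by linarith, by linarith, by linarith⟩
    · norm_num [G1]; rw [u2, u0]
      refine ⟨by linarith, by linarith, by linarith⟩
  have stp : ∀ e : ℤ, -1 ≤ e → e ≤ 1 → U ε (e-1) ≤ U ε (e+1) ∧
      U ε e ≤ (1-ε) * U ε (e+1) + ε * U ε (e-1) - ε*(1-ε)*(1-2*ε)/2 := by
    intro e he1 he2
    have : e = -1 ∨ e = 0 ∨ e = 1 := by omega
    rcases this with rfl | rfl | rfl
    · norm_num
      rw [u0, um1, um2]
      constructor
      · linarith
      · exact le_of_eq (by ring)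
    · norm_num
      refine ⟨mono1, ?_⟩
      rw [u0, um1, u1]
      exact le_of_eq (by ring)
    · norm_num
      rw [u2, u1, u0]
      constructor
      · linarith
      · exact le_of_eq (by ring)
  have hsg : ∀ D : ℤ, -1 ≤ D → D ≤ 1 → -1 ≤ sg b D ∧ sg b D ≤ 1 := by
    intro D h1 h2
    cases b <;> simp [sg] <;> omega
  induction k generalizing D bb with
  | zero =>
    have := guess_succ (J := J) (Prod.fst : ℤ × Option ℕ → ℤ) (D, some bb) x b
    simp only [mach]
    rw [this]
    obtain ⟨e1, e2⟩ := hsg D hD1 hD2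
    have := (tmo _ e1 e2).2.2
    have := hbl bb hb
    push_cast
    linarith
  | succ k ih =>
    have hns : jhalt (D, some bb) = false := by simp [jhalt]; omega
    rw [mach, step_succ _ _ _ _ _ _ hns]
    obtain ⟨e1, e2⟩ := hsg D hD1 hD2
    obtain ⟨s1, s2⟩ := stp _ e1 e2
    have hk' : k ≤ m := by omega
    -- bound for continuing states, including halted ones
    have cont : ∀ (D' : ℤ) (b' : ℕ), b' ≤ N → -2 ≤ D' → D' ≤ 2 →
        U ε (sg b D') - 2 * L + l * (b' + 1) + η * k ≤
        ((mach A jbud jupd jhalt Prod.fst k).at (D', some b')).succProb x b := by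
      intro D' b' hb' h1' h2'
      by_cases hh : -1 ≤ D' ∧ D' ≤ 1
      · exact ih hk' D' b' hb' hh.1 hh.2
      · have hst : jhalt (D', some b') = true := by simp [jhalt]; omega
        rw [mach_succ_halt _ _ _ _ _ _ _ hst]
        have hUG : U ε (sg b D') = G (sg b D') := by
          have : D' = 2 ∨ D' = -2 := by omega
          rcases this with rfl | rfl <;> cases b <;> simp [sg, u2, um2, G2, Gm2]
        have := hbl b' hb'
        have := hηk k hk'
        simp only
        rw [hUG]
        linarith
    have key := avg_bound A x b ε T hs hc
      (U ε (sg b D - 1) - 2 * L + l * (bb + 1) + η * k)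
      (U ε (sg b D + 1) - U ε (sg b D - 1)) l (by linarith) hl
      (fun ω => ((mach A jbud jupd jhalt Prod.fst k).at
        (nxt jbud jupd (A.tree ω) x (D, some bb))).succProb x b) (by
        intro ω
        have hU : U ε (sg b D - 1) + (if (A.tree ω).output x = b then
            (U ε (sg b D + 1) - U ε (sg b D - 1)) else 0) =
            U ε (sg b (D + pm ((A.tree ω).output x))) := by
          rw [sg_pm]
          split_ifs
          · ring
          · rw [add_zero, sub_eq_add_neg]
        by_cases hcb : (A.tree ω).cost x ≤ bb
        · have hn : nxt jbud jupd (A.tree ω) x (D, some bb) =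
              (D + pm ((A.tree ω).output x), some (bb - (A.tree ω).cost x)) := by
            simp [nxt, jbud, jupd, hcb]
          rw [hn]
          have hp : -1 ≤ pm ((A.tree ω).output x) ∧ pm ((A.tree ω).output x) ≤ 1 := by
            cases (A.tree ω).output x <;> simp [pm]
          have := cont (D + pm ((A.tree ω).output x)) (bb - (A.tree ω).cost x) (by omega)
            (by omega) (by omega)
          rw [← hU] at this
          rw [Nat.cast_sub hcb] at this
          linarith
        · have hn : nxt jbud jupd (A.tree ω) x (D, some bb) = (D, none) := by
            simp [nxt, jbud, jupd, hcb]
          rw [hn, mach_succ_halt _ _ _ _ _ _ _ (by simp [jhalt])]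
          have hG : U ε (sg b (D + pm ((A.tree ω).output x))) - L ≤ G (sg b D) := by
            rw [sg_pm]
            split_ifs
            · exact (tmo _ e1 e2).1
            · exact (tmo _ e1 e2).2.1
          rw [← hU] at hG
          have hcb' : (bb : ℝ) + 1 ≤ (A.tree ω).cost x := by
            have : bb + 1 ≤ (A.tree ω).cost x := by omega
            exact_mod_cast this
          have := mul_le_mul_of_nonneg_left hcb' hl
          have := hηk k hk'
          simp only
          linarith)
    refine le_trans ?_ key
    push_cast
    linarith

theorem joint_alg {n : ℕ} (f : PFn (Fin n) Bool Bool) (A : RandAlg (Fin n) Bool Bool)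
    (ε T B μ : ℝ) (h0 : 0 < ε) (h1 : ε < 1/2) (hT : 0 < T) (hA : A.Computes f ε)
    (hE : A.ECostLe f T) (hB : 0 < B) (hμ : 0 < μ) (hμ' : μ < ε*(1-ε)*(1-2*ε)/2)
    (g1 : 1/3 ≤ μ * B) (g0 : U ε 1 - μ * B ≤ 1/2) (gm : (1 - ε) - μ * B ≤ 1/3) :
    Rw ε f ≤ B * T := by
  set N := ⌊B * T⌋₊ with hN
  set l := μ / T with hl
  set L := l * ((N:ℝ)+1) with hL
  have hlp : 0 < l := by positivity
  have hLp : 0 < L := by positivity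
  have hLB : μ * B ≤ L := by
    have : B * T < N + 1 := Nat.lt_floor_add_one _
    calc μ * B = l * (B * T) := by rw [hl]; field_simp
      _ ≤ L := by rw [hL]; gcongr
  obtain ⟨m, hm⟩ := exists_nat_gt (L / (ε*(1-ε)*(1-2*ε)/2 - μ))
  have hd : 0 < ε*(1-ε)*(1-2*ε)/2 - μ := by linarith
  have hmp : (0:ℝ) < m := lt_trans (by positivity) hm
  have hlT : l * T = μ := by rw [hl]; field_simp
  have hstep : l * T + L / m ≤ ε*(1-ε)*(1-2*ε)/2 := by
    rw [hlT]
    rw [div_lt_iff₀ hd] at hm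
    have : L / m ≤ ε*(1-ε)*(1-2*ε)/2 - μ := by
      rw [div_le_iff₀ hmp]; linarith
    linarith
  have hmm : L / m * m = L := by field_simp
  apply csInf_le ⟨0, fun t ht => ht.1⟩
  refine ⟨by positivity, (mach A jbud jupd jhalt Prod.fst m).at (0, some N), ?_, ?_⟩
  · intro x b hx
    have := joint_succ A x b ε T h0 h1 (hA x b hx) (hE x (by simp [hx])) l (L / m) L m N hlp.le
      (by positivity) hL hmm hstep (by linarith) (by linarith) (by linarith) m le_rfl 0 N le_rfl
      (by norm_num) (by norm_num)
    refine le_trans ?_ this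
    rw [hmm]
    have : U ε (sg b 0) = 1 - ε := by cases b <;> norm_num [sg, U]
    rw [this]
    linarith
  · intro r _ x
    have h := joint_cost A m (0, some N) r x
    have h' : (jbud ((0, some N) : ℤ × Option ℕ) : ℝ) ≤ B * T :=
      Nat.floor_le (by positivity)
    exact le_trans (by exact_mod_cast h) h'

/-! ### The individual-budget machine, for small error -/

def iupd (s : ℤ) : Option Bool → ℕ → ℤ
  | none, _ => s
  | some o, _ => s + pm o

theorem ind_cost {J : Type} (A : RandAlg J Bool Bool) (M k : ℕ) (s : ℤ) (r) (x : J → Bool) :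
    ((mach A (fun _ => M) iupd (fun _ => false) id k).tree s r).cost x ≤ k * M := by
  induction k generalizing s with
  | zero => simp [mach, guessFam, DTree.cost]
  | succ k ih =>
    simp only [mach, stepFam, Bool.false_eq_true, if_false]
    apply bindT_cost
    intro o b' hb
    have := ih (iupd s o b') r.2
    rw [Nat.succ_mul]
    omega

theorem G_lower (e : ℤ) : 1 - (1/2 : ℝ) ^ e ≤ G e := by
  have h : e ≤ -2 ∨ e = -1 ∨ e = 0 ∨ e = 1 ∨ 2 ≤ e := by omega
  rcases h with h | h | h | h | h
  · have : (1/2 : ℝ)^(0:ℤ) ≤ (1/2 : ℝ)^e :=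
      zpow_le_zpow_right_of_le_one₀ (by norm_num) (by norm_num) (by omega)
    simp only [G, h, if_true]
    simp only [zpow_zero] at this
    linarith
  · subst h; norm_num [G]
  · subst h; norm_num [G]
  · subst h; norm_num [G]
  · have f1 : ¬ (e ≤ -2) := by omega
    have f2 : ¬ (e = -1) := by omega
    have f3 : ¬ (e = 0) := by omega
    have f4 : ¬ (e = 1) := by omega
    simp only [G, f1, f2, f3, f4, if_false]
    have : (0:ℝ) < (1/2 : ℝ)^e := by positivity
    linarith

theorem ind_succ {J : Type} (A : RandAlg J Bool Bool) (x : J → Bool) (b : Bool) (ε T : ℝ)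
    (h1 : ε ≤ 1/18) (hT : 0 < T)
    (hs : 1 - ε ≤ A.succProb x b) (hc : A.expCost x ≤ T) (M : ℕ) (hM : 3 * T < M + 1)
    (k : ℕ) (D : ℤ) :
    1 - (3/4 : ℝ) ^ k * (1/2 : ℝ) ^ (sg b D) ≤
      ((mach A (fun _ => M) iupd (fun _ => false) id k).at D).succProb x b := by
  induction k generalizing D with
  | zero =>
    have := guess_succ (J := J) (id : ℤ → ℤ) D x b
    simp only [mach]
    rw [this, pow_zero, one_mul]
    exact G_lower _
  | succ k ih =>
    rw [mach, step_succ _ _ _ _ _ _ rfl]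
    set v : ℝ := (1/2 : ℝ) ^ (sg b D) with hv
    set w : ℝ := (3/4 : ℝ) ^ k * v with hw
    have hvp : 0 < v := by positivity
    have hwp : 0 < w := by positivity
    have key := avg_bound A x b ε T hs hc (1 - w * 2) (w * (3/2)) (w / (6 * T))
      (by positivity) (by positivity)
      (fun ω => ((mach A (fun _ => M) iupd (fun _ => false) id k).at
        (nxt (fun _ => M) iupd (A.tree ω) x D)).succProb x b) (by
        intro ω
        by_cases hcb : (A.tree ω).cost x ≤ M
        · have hn : nxt (fun _ => M) iupd (A.tree ω) x D = D + pm ((A.tree ω).output x) := by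
            simp [nxt, iupd, hcb]
          rw [hn]
          have h := ih (D + pm ((A.tree ω).output x))
          refine le_trans ?_ h
          have hp : 0 ≤ w / (6 * T) * (A.tree ω).cost x := by positivity
          rw [sg_pm]
          split_ifs
          · rw [zpow_add₀ (by norm_num), ← hv, ← mul_assoc, ← hw]
            norm_num
            linarith
          · rw [zpow_add₀ (by norm_num), ← hv, ← mul_assoc, ← hw]
            norm_num
            linarith
        · have hn : nxt (fun _ => M) iupd (A.tree ω) x D = D := by
            simp [nxt, iupd, hcb]
          rw [hn]
          refine le_trans ?_ (ih D)
          have hcb' : 3 * T ≤ (A.tree ω).cost x := by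
            have : M + 1 ≤ (A.tree ω).cost x := by omega
            have : (M : ℝ) + 1 ≤ (A.tree ω).cost x := by exact_mod_cast this
            linarith
          have hp : w / 2 ≤ w / (6 * T) * (A.tree ω).cost x := by
            calc w / 2 = w / (6 * T) * (3 * T) := by field_simp; norm_num
              _ ≤ _ := by gcongr
          split_ifs <;> linarith)
    refine le_trans ?_ key
    have e1 : w / (6 * T) * T = w / 6 := by field_simp
    rw [e1, pow_succ]
    have : (3/4 : ℝ)^k * (3/4) * v = w * (3/4) := by rw [hw]; ring
    rw [this]
    nlinarith

theorem ind_alg {n : ℕ} (f : PFn (Fin n) Bool Bool) (A : RandAlg (Fin n) Bool Bool)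
    (ε T : ℝ) (m : ℕ) (h1 : ε ≤ 1/18) (hT : 0 < T) (hA : A.Computes f ε)
    (hE : A.ECostLe f T) (hm : (3/4 : ℝ)^m ≤ ε) :
    Rw ε f ≤ m * (3 * T) := by
  apply csInf_le ⟨0, fun t ht => ht.1⟩
  refine ⟨by positivity, (mach A (fun _ => ⌊3 * T⌋₊) iupd (fun _ => false) id m).at 0, ?_, ?_⟩
  · intro x b hx
    refine le_trans ?_ (ind_succ A x b ε T h1 hT (hA x b hx) (hE x (by simp [hx])) _
      (Nat.lt_floor_add_one _) m 0)
    have : (1/2 : ℝ)^(sg b 0) = 1 := by cases b <;> simp [sg]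
    rw [this]; linarith
  · intro r _ x
    have h := ind_cost A ⌊3 * T⌋₊ m 0 r x
    have h2 : (⌊3 * T⌋₊ : ℝ) ≤ 3 * T := Nat.floor_le (by positivity)
    calc _ ≤ ((m * ⌊3 * T⌋₊ : ℕ) : ℝ) := by exact_mod_cast h
      _ = m * (⌊3 * T⌋₊ : ℝ) := by push_cast; ring
      _ ≤ _ := by gcongr

/-! ### Passing to the infimum -/

theorem inf_bound {n : ℕ} (f : PFn (Fin n) Bool Bool) (ε C : ℝ) (hC : 0 < C)
    (h : ∀ T : ℝ, 0 < T → ∀ A : RandAlg (Fin n) Bool Bool, A.Computes f ε → A.ECostLe f T →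
      Rw ε f ≤ C * T) : Rw ε f ≤ C * Rbar ε f := by
  by_cases hne : ({T : ℝ | 0 ≤ T ∧ ∃ A : RandAlg (Fin n) Bool Bool,
      A.Computes f ε ∧ A.ECostLe f T}).Nonempty
  · have : Rw ε f / C ≤ Rbar ε f := by
      apply le_csInf hne
      rintro T ⟨hT0, A, hA, hE⟩
      apply le_of_forall_pos_le_add
      intro δ hδ
      have := h (T + δ) (by linarith) A hA (fun x hx => (hE x hx).trans (by linarith))
      rw [div_le_iff₀ hC]
      linarith
    rw [div_le_iff₀ hC] at this
    linarith
  · have e1 := Set.not_nonempty_iff_eq_empty.mp hne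
    have e2 : {T : ℝ | 0 ≤ T ∧ ∃ A : RandAlg (Fin n) Bool Bool,
      A.Computes f ε ∧ A.WCostLe T} = ∅ := by
      rw [Set.eq_empty_iff_forall_notMem]
      rintro T ⟨hT, A, hA, hW⟩
      apply hne
      refine ⟨T, hT, A, hA, fun x _ => ?_⟩
      letI := A.fin
      unfold RandAlg.expCost
      calc ∑ ω, A.p ω * ((A.tree ω).cost x : ℝ) ≤ ∑ ω, A.p ω * T := by
            refine Finset.sum_le_sum fun ω _ => ?_
            by_cases hp : A.p ω = 0
            · simp [hp]
            · exact mul_le_mul_of_nonneg_left (hW ω hp x) (A.nonneg ω)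
        _ = T := by rw [← Finset.sum_mul, A.sum_one, one_mul]
    unfold Rw Rbar
    rw [e1, e2]
    simp

end RwAux

open RwAux in
/-- **Worst-case versus expected cost at the same error:** for every partial Boolean
function `f` and every `ε ∈ (0, 1/2)`,
`R_ε(f) ≤ 14 · (ln(1/ε)/(1 − 2ε)²) · R̄_ε(f)`; for `ε = 1/3` this improves to
`R(f) ≤ 10 · R̄(f)`. -/
theorem Rw_le_const_mul_Rbar {n : ℕ} (f : PFn (Fin n) Bool Bool) :
    (∀ ε : ℝ, 0 < ε → ε < 1/2 →
      Rw ε f ≤ 14 * (Real.log (1/ε) / (1 - 2*ε)^2) * Rbar ε f) ∧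
    Rb f ≤ 10 * Rbar (1/3) f := by
  constructor
  · intro ε h0 h1
    have hγ : 0 < 1 - 2*ε := by linarith
    have hlog : 0 < Real.log (1/ε) := by
      apply Real.log_pos
      rw [lt_div_iff₀ h0]; linarith
    set L := Real.log (1/ε) with hL
    have hB : 0 < 14 * (L / (1 - 2*ε)^2) := by positivity
    have hlog2 : 1/ε ≥ 8 → 2 ≤ L := by
      intro h
      have h8 : Real.log 8 ≤ L := Real.log_le_log (by norm_num) h
      have : Real.log 8 = 3 * Real.log 2 := by
        rw [show (8:ℝ) = 2^3 by norm_num, Real.log_pow]; norm_num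
      have := Real.log_two_gt_d9
      linarith
    apply inf_bound f ε _ hB
    intro T hT A hA hE
    by_cases hε : ε ≤ 1/20
    · have hL2 : 2 ≤ L := hlog2 (by rw [ge_iff_le, le_div_iff₀ h0]; linarith)
      set m := ⌈4 * L⌉₊ with hm
      have hm1 : 4 * L ≤ m := Nat.le_ceil _
      have hm2 : (m:ℝ) < 4 * L + 1 := Nat.ceil_lt_add_one (by positivity)
      have hpow : (3/4 : ℝ)^m ≤ ε := by
        have h34 : (3/4 : ℝ) ≤ Real.exp (-(1/4)) := by
          have := Real.add_one_le_exp (-(1/4) : ℝ)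
          linarith
        calc (3/4 : ℝ)^m ≤ (Real.exp (-(1/4)))^m := by gcongr
          _ = Real.exp (m * (-(1/4))) := by rw [Real.exp_nat_mul]
          _ ≤ Real.exp (-L) := by apply Real.exp_le_exp.mpr; linarith
          _ = ε := by
            rw [hL, one_div, Real.log_inv, neg_neg, Real.exp_log h0]
      refine (ind_alg f A ε T m (by linarith) hT hA hE hpow).trans ?_
      have hg : L ≤ L / (1 - 2*ε)^2 := by
        rw [le_div_iff₀ (by positivity)]
        have : (1 - 2*ε)^2 ≤ 1 := by nlinarith
        nlinarith
      rw [← mul_assoc]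
      apply mul_le_mul_of_nonneg_right _ hT.le
      linarith
    · push Not at hε
      have hkey : (1 - 2*ε) < 21/2 * L * (ε * (1-ε)) := by
        have hpq : 0 < ε * (1-ε) := by nlinarith
        by_cases h8 : ε ≤ 1/8
        · have hL2 : 2 ≤ L := hlog2 (by rw [ge_iff_le, le_div_iff₀ h0]; linarith)
          have : 21/2 * 2 * (ε * (1-ε)) ≤ 21/2 * L * (ε * (1-ε)) := by gcongr
          nlinarith
        · push Not at h8
          have hL1 : 1 - ε ≤ L := by
            have := Real.one_sub_inv_le_log_of_pos (x := 1/ε) (by positivity)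
            rwa [one_div, inv_inv, ← one_div] at this
          have : 21/2 * (1-ε) * (ε * (1-ε)) ≤ 21/2 * L * (ε * (1-ε)) := by gcongr
          nlinarith [mul_pos h0 hγ, mul_pos (mul_pos h0 hγ) hγ, mul_pos hγ hγ]
      have hμB : (2/3) / (14 * (L / (1 - 2*ε)^2)) * (14 * (L / (1 - 2*ε)^2)) = 2/3 :=
        div_mul_cancel₀ _ hB.ne'
      have hU : U ε 1 ≤ 1 := by
        have : U ε 1 = (1-ε) + ε*(1-ε) - ε*(1-ε)*(1-2*ε)/2 := by norm_num [U]
        rw [this]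
        have : 0 < ε*(1-ε)*(1-2*ε) := mul_pos (by nlinarith) hγ
        nlinarith
      refine joint_alg f A ε T _ ((2/3) / (14 * (L / (1 - 2*ε)^2))) h0 h1 hT hA hE hB
        (by positivity) ?_ ?_ ?_ ?_
      · rw [div_lt_iff₀ hB]
        have : ε * (1 - ε) * (1 - 2*ε) / 2 * (14 * (L / (1 - 2*ε)^2)) =
            7 * L * (ε * (1-ε)) / (1 - 2*ε) := by field_simp; ring
        rw [this, lt_div_iff₀ hγ]
        linarith
      · rw [hμB]; norm_num
      · rw [hμB]; linarith
      · rw [hμB]; linarith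
  · unfold Rb
    apply inf_bound f _ _ (by norm_num)
    intro T hT A hA hE
    refine joint_alg f A (1/3) T 10 (73/2000) (by norm_num) (by norm_num) hT hA hE (by norm_num)
      (by norm_num) (by norm_num) (by norm_num) ?_ (by norm_num)
    norm_num [U]
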